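/- The probability that two distinct uniformly random 4×4 S-permutation matrices are disjoint is 7/15; that is, the number of unordered disjoint pairs of 4×4 S-permutation matrices divided by the total number of unordered pairs of distinct 4×4 S-permutation matrices equals, as a rational number, 7/15. -/

import Mathlib

def IsSPerm (n : ℕ) (A : (Fin n × Fin n) → (Fin n × Fin n) → Fin 2) : Prop :=
  (∀ r : Fin n × Fin n, ∃! c : Fin n × Fin n, A r c = 1) ∧
  (∀ c : Fin n × Fin n, ∃! r : Fin n × Fin n, A r c = 1) ∧
  (∀ k l : Fin n, ∃! p : Fin n × Fin n, A (k, p.1) (l, p.2) = 1)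

def DisjointS (n : ℕ) (A B : (Fin n × Fin n) → (Fin n × Fin n) → Fin 2) : Prop :=
  ¬ ∃ r c : Fin n × Fin n, A r c = 1 ∧ B r c = 1

/-- The `4 × 4` matrix whose block `(k, l)` has its only entry `1` in row `p.1 k + l` and
column `p.2 l + k` of the block. -/
def blockMatrix (p : (Fin 2 → Fin 2) × (Fin 2 → Fin 2)) :
    (Fin 2 × Fin 2) → (Fin 2 × Fin 2) → Fin 2 :=
  fun r c => if r.2 = p.1 r.1 + c.1 ∧ c.2 = p.2 c.1 + r.1 then 1 else 0

theorem blockMatrix_eq_one_iff (p : (Fin 2 → Fin 2) × (Fin 2 → Fin 2)) (r c : Fin 2 × Fin 2) :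
    blockMatrix p r c = 1 ↔ r.2 = p.1 r.1 + c.1 ∧ c.2 = p.2 c.1 + r.1 := by
  simp [blockMatrix]

theorem blockMatrix_injective : Function.Injective blockMatrix := by
  rintro ⟨a, b⟩ ⟨a', b'⟩ h
  have key (k l : Fin 2) : a k + l = a' k + l ∧ b l + k = b' l + k := by
    rw [← blockMatrix_eq_one_iff (a', b') (k, a k + l) (l, b l + k), ← h, blockMatrix_eq_one_iff]
    exact ⟨rfl, rfl⟩
  ext1
  · exact funext fun k => add_right_cancel (key k 0).1
  · exact funext fun l => add_right_cancel (key 0 l).2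

theorem isSPerm_blockMatrix (p : (Fin 2 → Fin 2) × (Fin 2 → Fin 2)) :
    IsSPerm 2 (blockMatrix p) := by
  obtain ⟨a, b⟩ := p
  simp only [IsSPerm, blockMatrix_eq_one_iff]
  refine ⟨?_, ?_, ?_⟩
  · rintro ⟨k, i⟩
    refine ⟨(i - a k, b (i - a k) + k), by simp, ?_⟩
    rintro ⟨l, j⟩ ⟨h, h'⟩
    obtain rfl : l = i - a k := eq_sub_of_add_eq' h.symm
    exact Prod.ext rfl h'
  · rintro ⟨l, j⟩
    refine ⟨(j - b l, a (j - b l) + l), by simp, ?_⟩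
    rintro ⟨k, i⟩ ⟨h, h'⟩
    obtain rfl : k = j - b l := eq_sub_of_add_eq' h'.symm
    exact Prod.ext rfl h
  · exact fun k l => ⟨(a k + l, b l + k), ⟨rfl, rfl⟩, fun q hq => Prod.ext hq.1 hq.2⟩

theorem isSPerm_two_iff (A : (Fin 2 × Fin 2) → (Fin 2 × Fin 2) → Fin 2) :
    IsSPerm 2 A ↔ ∃ p, blockMatrix p = A := by
  refine ⟨fun ⟨hrow, hcol, hblock⟩ => ?_, fun ⟨p, hp⟩ => hp ▸ isSPerm_blockMatrix p⟩
  choose p hp hu using hblock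
  have hr (k : Fin 2) : (p k 0).1 ≠ (p k 1).1 := fun h => by
    have := (hrow (k, (p k 0).1)).unique (hp k 0) (by rw [h]; exact hp k 1)
    simp at this
  have hc (l : Fin 2) : (p 0 l).2 ≠ (p 1 l).2 := fun h => by
    have := (hcol (l, (p 0 l).2)).unique (hp 0 l) (by rw [h]; exact hp 1 l)
    simp at this
  have succ_of_ne : ∀ x y : Fin 2, x ≠ y → y = x + 1 := by decide
  have h₁ (k l : Fin 2) : (p k l).1 = (p k 0).1 + l := by
    fin_cases l
    · simp
    · exact succ_of_ne _ _ (hr k)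
  have h₂ (k l : Fin 2) : (p k l).2 = (p 0 l).2 + k := by
    fin_cases k
    · simp
    · exact succ_of_ne _ _ (hc l)
  have eq_of_eq_one_iff : ∀ x y : Fin 2, (x = 1 ↔ y = 1) → x = y := by decide
  refine ⟨(fun k => (p k 0).1, fun l => (p 0 l).2), ?_⟩
  funext ⟨k, i⟩ ⟨l, j⟩
  apply eq_of_eq_one_iff
  rw [blockMatrix_eq_one_iff]
  dsimp only
  rw [← h₁, ← h₂]
  exact ⟨fun ⟨hi, hj⟩ => by rw [hi, hj]; exact hp k l,
    fun h => Prod.ext_iff.1 (hu k l (i, j) h)⟩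

theorem disjointS_blockMatrix_iff (p q : (Fin 2 → Fin 2) × (Fin 2 → Fin 2)) :
    DisjointS 2 (blockMatrix p) (blockMatrix q) ↔
      ∀ k l, ¬ (p.1 k = q.1 k ∧ p.2 l = q.2 l) := by
  simp only [DisjointS, blockMatrix_eq_one_iff, not_exists]
  constructor
  · intro h k l ⟨h₁, h₂⟩
    exact h (k, p.1 k + l) (l, p.2 l + k) ⟨⟨rfl, rfl⟩, by simp [h₁], by simp [h₂]⟩
  · rintro h ⟨k, i⟩ ⟨l, j⟩ ⟨⟨h₁, h₂⟩, h₃, h₄⟩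
    exact h k l ⟨add_right_cancel (h₁.symm.trans h₃), add_right_cancel (h₂.symm.trans h₄)⟩

/-- The graph of disjointness of S-permutation matrices, in terms of the parameters of
`blockMatrix`. -/
def disjointGraph : SimpleGraph ((Fin 2 → Fin 2) × (Fin 2 → Fin 2)) where
  Adj p q := ∀ k l, ¬ (p.1 k = q.1 k ∧ p.2 l = q.2 l)
  symm := ⟨fun _ _ h k l hkl => h k l ⟨hkl.1.symm, hkl.2.symm⟩⟩
  loopless := ⟨fun _ h => h 0 0 ⟨rfl, rfl⟩⟩

instance : DecidableRel disjointGraph.Adj := fun p q =>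
  inferInstanceAs (Decidable (∀ k l, ¬ (p.1 k = q.1 k ∧ p.2 l = q.2 l)))

set_option maxRecDepth 10000 in
theorem disjointGraph_isRegularOfDegree : disjointGraph.IsRegularOfDegree 7 := by
  unfold SimpleGraph.IsRegularOfDegree
  decide

theorem card_edgeFinset_disjointGraph : disjointGraph.edgeFinset.card = 56 := by
  have h := disjointGraph.sum_degrees_eq_twice_card_edges
  simp only [disjointGraph_isRegularOfDegree.degree_eq, Finset.sum_const, Finset.card_univ,
    Fintype.card_prod, Fintype.card_fun, Fintype.card_fin, smul_eq_mul] at h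
  omega

theorem SimpleGraph.card_adj_pairs {V M : Type*} (G : SimpleGraph V) [Fintype G.edgeSet]
    {f : V → M} (hf : Function.Injective f) :
    Nat.card {s : Set M // ∃ a b, G.Adj a b ∧ s = {f a, f b}} = G.edgeFinset.card := by
  have hinj : Function.Injective fun e : Sym2 V => (e.map f : Set M) :=
    SetLike.coe_injective.comp (Sym2.map.injective hf)
  have himage : {s : Set M | ∃ a b, G.Adj a b ∧ s = {f a, f b}} =
      (fun e : Sym2 V => (e.map f : Set M)) '' G.edgeSet := by
    ext s
    simp only [Set.mem_image, Set.mem_ofPred_eq, Sym2.exists, SimpleGraph.mem_edgeSet,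
      Sym2.map_mk, Sym2.coe_mk, eq_comm]
  rw [← Set.coe_ofPred, Nat.card_coe_set_eq, himage, Set.ncard_image_of_injective _ hinj,
    ← SimpleGraph.coe_edgeFinset, Set.ncard_coe_finset]

/-- The number of unordered disjoint pairs of `4 × 4` S-permutation matrices
divided by the total number of unordered pairs of distinct `4 × 4`
S-permutation matrices equals `7/15`. -/
theorem probability_disjoint_two :
    (Nat.card {s : Set ((Fin 2 × Fin 2) → (Fin 2 × Fin 2) → Fin 2) //
        ∃ A B, IsSPerm 2 A ∧ IsSPerm 2 B ∧ A ≠ B ∧ DisjointS 2 A B ∧ s = {A, B}} : ℚ) /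
      (Nat.card {s : Set ((Fin 2 × Fin 2) → (Fin 2 × Fin 2) → Fin 2) //
        ∃ A B, IsSPerm 2 A ∧ IsSPerm 2 B ∧ A ≠ B ∧ s = {A, B}} : ℚ) = 7 / 15 := by
  have hdisj : Nat.card {s : Set ((Fin 2 × Fin 2) → (Fin 2 × Fin 2) → Fin 2) //
      ∃ A B, IsSPerm 2 A ∧ IsSPerm 2 B ∧ A ≠ B ∧ DisjointS 2 A B ∧ s = {A, B}} = 56 := by
    rw [← card_edgeFinset_disjointGraph, ← disjointGraph.card_adj_pairs blockMatrix_injective]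
    refine Nat.card_congr (Equiv.subtypeEquivRight fun s => ?_)
    simp only [isSPerm_two_iff]
    constructor
    · rintro ⟨_, _, ⟨p, rfl⟩, ⟨q, rfl⟩, -, h, hs⟩
      exact ⟨p, q, (disjointS_blockMatrix_iff p q).1 h, hs⟩
    · rintro ⟨p, q, h, hs⟩
      exact ⟨_, _, ⟨p, rfl⟩, ⟨q, rfl⟩, blockMatrix_injective.ne h.ne,
        (disjointS_blockMatrix_iff p q).2 h, hs⟩
  have hpairs : Nat.card {s : Set ((Fin 2 × Fin 2) → (Fin 2 × Fin 2) → Fin 2) //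
      ∃ A B, IsSPerm 2 A ∧ IsSPerm 2 B ∧ A ≠ B ∧ s = {A, B}} = 120 := by
    have hcard : (⊤ : SimpleGraph ((Fin 2 → Fin 2) × (Fin 2 → Fin 2))).edgeFinset.card = 120 := by
      rw [SimpleGraph.card_edgeFinset_top_eq_card_choose_two]
      rfl
    rw [← hcard, ← SimpleGraph.card_adj_pairs _ blockMatrix_injective]
    refine Nat.card_congr (Equiv.subtypeEquivRight fun s => ?_)
    simp only [isSPerm_two_iff, SimpleGraph.top_adj]
    constructor
    · rintro ⟨_, _, ⟨p, rfl⟩, ⟨q, rfl⟩, h, hs⟩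
      exact ⟨p, q, ne_of_apply_ne _ h, hs⟩
    · rintro ⟨p, q, h, hs⟩
      exact ⟨_, _, ⟨p, rfl⟩, ⟨q, rfl⟩, blockMatrix_injective.ne h, hs⟩
  rw [hdisj, hpairs]
  norm_num
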